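/- Let C ⊆ ℝⁿ be a nonempty closed convex set, let h ∈ ℝⁿ, and let H, H' be symmetric positive-definite n×n real matrices such that the smallest eigenvalue of H' is at least λ > 0 and the operator norm ‖H − H'‖₂ ≤ 1. Let z* be the unique minimizer of z ↦ ½⟨z, Hz⟩ + ⟨h, z⟩ over C and let z'* be the unique minimizer of z ↦ ½⟨z, H'z⟩ + ⟨h, z⟩ over C. If ‖z*‖₂ ≤ G, then ‖z* − z'*‖₂ ≤ G/λ. -/

import Mathlib

open scoped RealInnerProductSpace

/-- First-order optimality of a minimizer of a quadratic over a convex set. -/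
theorem LinearMap.IsSymmetric.inner_sub_nonneg_of_quadratic_min {E : Type*}
    [NormedAddCommGroup E] [InnerProductSpace ℝ E] {T : E →ₗ[ℝ] E} (hT : T.IsSymmetric)
    {C : Set E} (hC : Convex ℝ C) {h x y : E} (hx : x ∈ C) (hy : y ∈ C)
    (hmin : ∀ z ∈ C, (1/2) * ⟪x, T x⟫ + ⟪h, x⟫ ≤ (1/2) * ⟪z, T z⟫ + ⟪h, z⟫) :
    0 ≤ ⟪y - x, T x⟫ + ⟪h, y - x⟫ := by
  obtain ⟨d, rfl⟩ : ∃ d, y = x + d := ⟨y - x, by abel⟩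
  rw [add_sub_cancel_left]
  have key : ∀ t : ℝ, 0 ≤ t → t ≤ 1 →
      0 ≤ t * (⟪d, T x⟫ + ⟪h, d⟫) + t ^ 2 / 2 * ⟪d, T d⟫ := by
    intro t ht0 ht1
    have hmem : x + t • d ∈ C := hC.add_smul_mem hx hy ⟨ht0, ht1⟩
    have hle := hmin _ hmem
    have hsymm : ⟪x, T d⟫ = ⟪d, T x⟫ := by rw [← hT x d, real_inner_comm]
    simp only [map_add, map_smul, inner_add_left, inner_add_right, real_inner_smul_left,
      real_inner_smul_right, hsymm] at hle
    linarith
  by_contra! ha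
  set a := ⟪d, T x⟫ + ⟪h, d⟫
  set q := ⟪d, T d⟫
  have hden : 0 < |q| - a := by linarith [abs_nonneg q]
  have ht : 0 < -a / (|q| - a) := div_pos (by linarith) hden
  have hk := key (-a / (|q| - a)) ht.le ((div_le_one hden).2 (by linarith [abs_nonneg q]))
  have hmul : -a / (|q| - a) * (|q| - a) = -a := div_mul_cancel₀ _ hden.ne'
  set t := -a / (|q| - a)
  have hq : t * q ≤ t * |q| := mul_le_mul_of_nonneg_left (le_abs_self q) ht.le
  have hneg : a + t / 2 * q < 0 := by nlinarith
  nlinarith [mul_neg_of_pos_of_neg ht hneg]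

/-- A Hermitian matrix is bounded below by any lower bound of its eigenvalues. -/
theorem Matrix.IsHermitian.mul_norm_sq_le_inner_toEuclideanLin {ι : Type*} [Fintype ι]
    [DecidableEq ι] {A : Matrix ι ι ℝ} (hA : A.IsHermitian) {c : ℝ}
    (hc : ∀ i, c ≤ hA.eigenvalues i) (x : EuclideanSpace ℝ ι) :
    c * ‖x‖ ^ 2 ≤ ⟪x, Matrix.toEuclideanLin A x⟫ := by
  have hT := Matrix.isSymmetric_toEuclideanLin_iff.2 hA
  have hb (i : ι) : Matrix.toEuclideanLin A (hA.eigenvectorBasis i) =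
      hA.eigenvalues i • hA.eigenvectorBasis i := by
    ext j
    simpa using congrFun (hA.mulVec_eigenvectorBasis i) j
  rw [← hA.eigenvectorBasis.sum_inner_mul_inner, ← real_inner_self_eq_norm_sq,
    ← hA.eigenvectorBasis.sum_inner_mul_inner, Finset.mul_sum]
  refine Finset.sum_le_sum fun i _ => ?_
  rw [← hT, hb, real_inner_smul_left, real_inner_comm x]
  nlinarith [mul_le_mul_of_nonneg_right (hc i) (mul_self_nonneg ⟪x, hA.eigenvectorBasis i⟫)]

/-- **Sensitivity bound for protecting `H`.**
If `H, H'` are symmetric positive definite, the smallest eigenvalue of `H'` is at least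
`lam > 0`, the operator norm `‖H - H'‖₂ ≤ 1`, and the minimizer `z*` of
`z ↦ ½⟨z, Hz⟩ + ⟨h, z⟩` over the nonempty closed convex set `C` satisfies `‖z*‖ ≤ G`,
then the minimizers `z*`, `z'*` (for `H` and `H'` resp.) satisfy `‖z* - z'*‖ ≤ G / lam`. -/
theorem stmt2 {n : ℕ} (C : Set (EuclideanSpace ℝ (Fin n)))
    (hCne : C.Nonempty) (hCcl : IsClosed C) (hCcv : Convex ℝ C)
    (h : EuclideanSpace ℝ (Fin n))
    (H H' : Matrix (Fin n) (Fin n) ℝ) (hH : H.PosDef) (hH' : H'.PosDef)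
    (lam : ℝ) (hlam : 0 < lam) (heig : ∀ i, lam ≤ hH'.1.eigenvalues i)
    (hop : ‖Matrix.toEuclideanCLM (𝕜 := ℝ) (H - H')‖ ≤ 1)
    (zs zs' : EuclideanSpace ℝ (Fin n)) (hzsC : zs ∈ C) (hzs'C : zs' ∈ C)
    (hzs : ∀ z ∈ C, (1/2) * ⟪zs, Matrix.toEuclideanLin H zs⟫ + ⟪h, zs⟫
      ≤ (1/2) * ⟪z, Matrix.toEuclideanLin H z⟫ + ⟪h, z⟫)
    (hzs' : ∀ z ∈ C, (1/2) * ⟪zs', Matrix.toEuclideanLin H' zs'⟫ + ⟪h, zs'⟫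
      ≤ (1/2) * ⟪z, Matrix.toEuclideanLin H' z⟫ + ⟪h, z⟫)
    (G : ℝ) (hG : ‖zs‖ ≤ G) :
    ‖zs - zs'‖ ≤ G / lam := by
  have h₁ := (Matrix.isSymmetric_toEuclideanLin_iff.2 hH.1).inner_sub_nonneg_of_quadratic_min
    hCcv hzsC hzs'C hzs
  have h₂ := (Matrix.isSymmetric_toEuclideanLin_iff.2 hH'.1).inner_sub_nonneg_of_quadratic_min
    hCcv hzs'C hzsC hzs'
  have hlow := hH'.1.mul_norm_sq_le_inner_toEuclideanLin heig (zs - zs')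
  have hup : ⟪zs' - zs, Matrix.toEuclideanLin (H - H') zs⟫ ≤ ‖zs - zs'‖ * G := by
    refine (real_inner_le_norm _ _).trans ?_
    rw [norm_sub_rev]
    gcongr
    exact ((Matrix.toEuclideanCLM (𝕜 := ℝ) (H - H')).le_of_opNorm_le hop zs).trans
      (by rwa [one_mul])
  have hmain : lam * ‖zs - zs'‖ ^ 2 ≤ ‖zs - zs'‖ * G := by
    simp only [map_sub, LinearMap.sub_apply, inner_sub_left, inner_sub_right] at *
    linarith
  rw [le_div_iff₀ hlam]
  rcases (norm_nonneg (zs - zs')).eq_or_lt with h0 | hpos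
  · rw [← h0, zero_mul]
    exact (norm_nonneg zs).trans hG
  · refine le_of_mul_le_mul_left ?_ hpos
    linarith
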